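/- Let C ≥ 0, let v : ℝ^d → ℝ be Lipschitz, compactly supported, and C-semiconvex, and let h be a C² function with compact support such that v + τh is C-semiconvex for all |τ| ≤ 1. Let φ^τ and φ denote the Hopf–Lax functions for quadratic cost with terminal data v + τh and v respectively. Then ∫₀¹ ∫_{ℝ^d} |∇φ^τ(t,x) − ∇φ(t,x)|² dx dt → 0 as τ → 0. -/

import Mathlib

open MeasureTheory Set Filter
open scoped Topology

/-- The Hopf–Lax function for quadratic cost with terminal datum `v` at time `1`:
`φ(t,x) = sup_y ( v(y) - |x-y|²/(2(1-t)) )` for `t < 1`, and `φ(1,x) = v(x)`. -/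
noncomputable def hopfLax (d : ℕ) (v : EuclideanSpace ℝ (Fin d) → ℝ)
    (t : ℝ) (x : EuclideanSpace ℝ (Fin d)) : ℝ :=
  if t = 1 then v x
  else ⨆ y : EuclideanSpace ℝ (Fin d), (v y - ‖x - y‖ ^ 2 / (2 * (1 - t)))

section Aux

variable {d : ℕ}

local notation "𝔼" => EuclideanSpace ℝ (Fin d)

/-- Hopf–Lax as a supremum over a compact ball of velocities. -/
noncomputable def hopfLaxBall (K : ℝ) (u : EuclideanSpace ℝ (Fin d) → ℝ) (s : ℝ)
    (x : EuclideanSpace ℝ (Fin d)) : ℝ :=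
  sSup ((fun w : EuclideanSpace ℝ (Fin d) => u (x - s • w) - s * ‖w‖ ^ 2 / 2) ''
    Metric.closedBall 0 (2 * K))

lemma hl_lip_le {K : NNReal} {u : 𝔼 → ℝ} (hu : LipschitzWith K u) (x y : 𝔼) :
    u y ≤ u x + K * ‖x - y‖ := by
  have := hu.dist_le_mul y x
  rw [Real.dist_eq, dist_eq_norm, norm_sub_rev] at this
  linarith [le_abs_self (u y - u x)]

lemma hl_bdd {K : NNReal} {u : 𝔼 → ℝ} (hu : LipschitzWith K u) {s : ℝ} (hs : 0 < s) (x : 𝔼) :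
    BddAbove (range fun y => u y - ‖x - y‖ ^ 2 / (2 * s)) := by
  refine ⟨u x + K ^ 2 * s / 2, ?_⟩
  rintro _ ⟨y, rfl⟩
  have h1 := hl_lip_le hu x y
  have h2 : K * ‖x - y‖ - ‖x - y‖ ^ 2 / (2 * s) ≤ K ^ 2 * s / 2 := by
    have : K ^ 2 * s / 2 - (K * ‖x - y‖ - ‖x - y‖ ^ 2 / (2 * s))
        = (‖x - y‖ - K * s) ^ 2 / (2 * s) := by
      field_simp; ring
    have h3 : 0 ≤ (‖x - y‖ - K * s) ^ 2 / (2 * s) := by positivity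
    linarith
  show u y - ‖x - y‖ ^ 2 / (2 * s) ≤ _
  linarith

lemma hl_eq (u : 𝔼 → ℝ) {t : ℝ} (ht : t < 1) (x : 𝔼) :
    hopfLax d u t x = ⨆ y : 𝔼, (u y - ‖x - y‖ ^ 2 / (2 * (1 - t))) := by
  simp [hopfLax, ht.ne]

lemma hl_ge {K : NNReal} {u : 𝔼 → ℝ} (hu : LipschitzWith K u) {t : ℝ} (ht : t < 1) (x y : 𝔼) :
    u y - ‖x - y‖ ^ 2 / (2 * (1 - t)) ≤ hopfLax d u t x := by
  rw [hl_eq u ht]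
  exact le_ciSup (hl_bdd hu (sub_pos.2 ht) x) y

lemma hl_le (u : 𝔼 → ℝ) {t : ℝ} (ht : t < 1) (x : 𝔼) (B : ℝ)
    (h : ∀ y, u y - ‖x - y‖ ^ 2 / (2 * (1 - t)) ≤ B) : hopfLax d u t x ≤ B := by
  rw [hl_eq u ht]
  exact ciSup_le h

lemma hl_lipschitz {K : NNReal} {u : 𝔼 → ℝ} (hu : LipschitzWith K u) {t : ℝ} (ht : t < 1) :
    LipschitzWith K (hopfLax d u t) := by
  refine LipschitzWith.of_le_add_mul K fun x x' => ?_
  refine hl_le u ht x _ fun y => ?_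
  have h1 := hl_ge hu ht x' (y + (x' - x))
  have h2 := hl_lip_le hu (y + (x' - x)) y
  have e1 : x' - (y + (x' - x)) = x - y := by abel
  have e2 : y + (x' - x) - y = x' - x := by abel
  rw [e1] at h1
  rw [e2, norm_sub_rev, ← dist_eq_norm] at h2
  linarith

lemma hl_semiconvex {K : NNReal} {u : 𝔼 → ℝ} (hu : LipschitzWith K u) {t : ℝ} (ht : t < 1)
    (x z : 𝔼) {θ : ℝ} (h0 : 0 < θ) (h1 : θ < 1) :
    hopfLax d u t (x + θ • z) ≤ (1 - θ) * hopfLax d u t x + θ * hopfLax d u t (x + z)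
      + θ * (‖z‖ ^ 2 / (2 * (1 - t))) := by
  refine hl_le u ht _ _ fun y => ?_
  have hs : 0 < 1 - t := sub_pos.2 ht
  have a1 := mul_le_mul_of_nonneg_left (hl_ge hu ht x y) (sub_pos.2 h1).le
  have a2 := mul_le_mul_of_nonneg_left (hl_ge hu ht (x + z) y) h0.le
  have e1 : x + θ • z - y = (x - y) + θ • z := by abel
  have e2 : x + z - y = (x - y) + z := by abel
  rw [e2] at a2
  rw [e1]
  have n1 := norm_add_sq_real (x - y) (θ • z)
  have n2 := norm_add_sq_real (x - y) z
  rw [inner_smul_right, norm_smul, Real.norm_eq_abs, mul_pow, sq_abs] at n1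
  have key : (1 - θ) * (u y - ‖x - y‖ ^ 2 / (2 * (1 - t)))
      + θ * (u y - ‖x - y + z‖ ^ 2 / (2 * (1 - t))) + θ * (‖z‖ ^ 2 / (2 * (1 - t)))
      - (u y - ‖x - y + θ • z‖ ^ 2 / (2 * (1 - t))) = θ ^ 2 * ‖z‖ ^ 2 / (2 * (1 - t)) := by
    rw [n1, n2]; field_simp; ring
  have : 0 ≤ θ ^ 2 * ‖z‖ ^ 2 / (2 * (1 - t)) := by positivity
  linarith

lemma hl_slope {f : 𝔼 → ℝ} {x : 𝔼} (hf : DifferentiableAt ℝ f x) (z : 𝔼) :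
    Tendsto (fun θ : ℝ => θ⁻¹ * (f (x + θ • z) - f x)) (𝓝[>] 0) (𝓝 (fderiv ℝ f x z)) := by
  have h := hf.hasFDerivAt.hasLineDerivAt z
  have h2 := h.tendsto_slope_zero_right
  simpa using h2

lemma hl_fderiv_le {f : 𝔼 → ℝ} {k : ℝ} {x : 𝔼}
    (hsc : ∀ z : 𝔼, ∀ θ : ℝ, 0 < θ → θ < 1 →
      f (x + θ • z) ≤ (1 - θ) * f x + θ * f (x + z) + θ * (‖z‖ ^ 2 / k))
    (hf : DifferentiableAt ℝ f x) (z : 𝔼) :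
    fderiv ℝ f x z ≤ f (x + z) - f x + ‖z‖ ^ 2 / k := by
  refine le_of_tendsto (hl_slope hf z) ?_
  filter_upwards [Ioo_mem_nhdsGT (zero_lt_one (α := ℝ))] with θ hθ
  have := hsc z θ hθ.1 hθ.2
  rw [inv_mul_le_iff₀ hθ.1]
  linarith

lemma hl_fderiv_upper {F : ℕ → 𝔼 → ℝ} {f : 𝔼 → ℝ} {k : ℝ} {x : 𝔼}
    (hF : ∀ᶠ n in atTop, ∀ z, fderiv ℝ (F n) x z ≤ F n (x + z) - F n x + ‖z‖ ^ 2 / k)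
    (hlim : ∀ y, Tendsto (fun n => F n y) atTop (𝓝 (f y)))
    (hf : DifferentiableAt ℝ f x) (z : 𝔼) (a : ℝ) (ha : fderiv ℝ f x z < a) :
    ∀ᶠ n in atTop, fderiv ℝ (F n) x z < a := by
  have h1 : Tendsto (fun θ : ℝ => θ⁻¹ * (f (x + θ • z) - f x) + θ * (‖z‖ ^ 2 / k)) (𝓝[>] 0)
      (𝓝 (fderiv ℝ f x z + 0 * (‖z‖ ^ 2 / k))) :=
    (hl_slope hf z).add ((tendsto_id.mono_left nhdsWithin_le_nhds).mul_const _)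
  rw [zero_mul, add_zero] at h1
  obtain ⟨θ, hθa, hθ⟩ := ((h1.eventually (gt_mem_nhds ha)).and self_mem_nhdsWithin).exists
  have hθ : 0 < θ := hθ
  have h2 : Tendsto (fun n => θ⁻¹ * (F n (x + θ • z) - F n x) + θ * (‖z‖ ^ 2 / k)) atTop
      (𝓝 (θ⁻¹ * (f (x + θ • z) - f x) + θ * (‖z‖ ^ 2 / k))) :=
    (((hlim _).sub (hlim _)).const_mul _).add_const _
  filter_upwards [h2.eventually (gt_mem_nhds hθa), hF] with n hn hFn
  refine lt_of_le_of_lt ?_ hn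
  have h3 := hFn (θ • z)
  rw [map_smul, smul_eq_mul, norm_smul, Real.norm_eq_abs, mul_pow, sq_abs] at h3
  have h4 := mul_le_mul_of_nonneg_left h3 (inv_pos.2 hθ).le
  have e1 : θ⁻¹ * (θ * fderiv ℝ (F n) x z) = fderiv ℝ (F n) x z := by field_simp
  have e2 : θ⁻¹ * (F n (x + θ • z) - F n x + θ ^ 2 * ‖z‖ ^ 2 / k)
      = θ⁻¹ * (F n (x + θ • z) - F n x) + θ * (‖z‖ ^ 2 / k) := by
    rw [mul_add]; congr 1; field_simp
  linarith

lemma hl_fderiv_tendsto {F : ℕ → 𝔼 → ℝ} {f : 𝔼 → ℝ} {k : ℝ} {x : 𝔼}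
    (hF : ∀ᶠ n in atTop, ∀ z, fderiv ℝ (F n) x z ≤ F n (x + z) - F n x + ‖z‖ ^ 2 / k)
    (hlim : ∀ y, Tendsto (fun n => F n y) atTop (𝓝 (f y)))
    (hf : DifferentiableAt ℝ f x) (z : 𝔼) :
    Tendsto (fun n => fderiv ℝ (F n) x z) atTop (𝓝 (fderiv ℝ f x z)) := by
  refine tendsto_order.2 ⟨fun a ha => ?_, fun a ha => hl_fderiv_upper hF hlim hf z a ha⟩
  have := hl_fderiv_upper hF hlim hf (-z) (-a) (by rw [map_neg]; linarith)
  filter_upwards [this] with n hn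
  rw [map_neg] at hn
  linarith

lemma hl_gradient_apply (f : 𝔼 → ℝ) (x : 𝔼) (i : Fin d) :
    gradient f x i = fderiv ℝ f x (EuclideanSpace.single i 1) := by
  have : inner ℝ (gradient f x) (EuclideanSpace.single i (1 : ℝ))
      = fderiv ℝ f x (EuclideanSpace.single i 1) := by
    rw [gradient, InnerProductSpace.toDual_symm_apply]
  rw [← this, EuclideanSpace.inner_single_right]
  simp

lemma hl_gradient_tendsto {F : ℕ → 𝔼 → ℝ} {f : 𝔼 → ℝ} {k : ℝ} {x : 𝔼}
    (hF : ∀ᶠ n in atTop, ∀ z, fderiv ℝ (F n) x z ≤ F n (x + z) - F n x + ‖z‖ ^ 2 / k)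
    (hlim : ∀ y, Tendsto (fun n => F n y) atTop (𝓝 (f y)))
    (hf : DifferentiableAt ℝ f x) :
    Tendsto (fun n => ‖gradient (F n) x - gradient f x‖ ^ 2) atTop (𝓝 0) := by
  have e : ∀ n, ‖gradient (F n) x - gradient f x‖ ^ 2 =
      ∑ i, (fderiv ℝ (F n) x (EuclideanSpace.single i 1)
        - fderiv ℝ f x (EuclideanSpace.single i 1)) ^ 2 := by
    intro n
    rw [EuclideanSpace.norm_sq_eq]
    refine Finset.sum_congr rfl fun i _ => ?_
    rw [Real.norm_eq_abs, sq_abs, PiLp.sub_apply, hl_gradient_apply, hl_gradient_apply]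
  simp_rw [e]
  have : Tendsto (fun n => ∑ i, (fderiv ℝ (F n) x (EuclideanSpace.single i 1)
        - fderiv ℝ f x (EuclideanSpace.single i 1)) ^ 2) atTop
      (𝓝 (∑ i : Fin d, (fderiv ℝ f x (EuclideanSpace.single i 1)
        - fderiv ℝ f x (EuclideanSpace.single i 1)) ^ 2)) :=
    tendsto_finsetSum _ fun i _ =>
      ((hl_fderiv_tendsto hF hlim hf _).sub_const _).pow 2
  simpa using this

lemma hl_gradient_norm_le {f : 𝔼 → ℝ} {K : NNReal} (hf : LipschitzWith K f) (x : 𝔼) :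
    ‖gradient f x‖ ≤ K := by
  rw [gradient, LinearIsometryEquiv.norm_map]
  exact norm_fderiv_le_of_lipschitz ℝ hf

lemma hlb_continuous (K : ℝ) {u : 𝔼 → ℝ} (hu : Continuous u) :
    Continuous (Function.uncurry (hopfLaxBall (d := d) K u)) := by
  have := IsCompact.continuous_sSup (isCompact_closedBall (0 : 𝔼) (2 * K))
    (f := fun (p : ℝ × 𝔼) w => u (p.2 - p.1 • w) - p.1 * ‖w‖ ^ 2 / 2) (by
      simp only [Function.HasUncurry.uncurry, id]
      fun_prop)
  exact this

lemma hl_eq_hlb {K : NNReal} {u : 𝔼 → ℝ} (hu : LipschitzWith K u) {t : ℝ} (ht : t < 1) :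
    hopfLax d u t = hopfLaxBall (d := d) K u (1 - t) := by
  funext x
  have hs : 0 < 1 - t := sub_pos.2 ht
  set s := 1 - t with hsdef
  have hbd : BddAbove ((fun w : 𝔼 => u (x - s • w) - s * ‖w‖ ^ 2 / 2) ''
      Metric.closedBall 0 (2 * (K : ℝ))) := by
    refine (isCompact_closedBall _ _).bddAbove_image ?_
    have := hu.continuous
    fun_prop
  have term : ∀ w : 𝔼, u (x - s • w) - ‖x - (x - s • w)‖ ^ 2 / (2 * s)
      = u (x - s • w) - s * ‖w‖ ^ 2 / 2 := by
    intro w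
    rw [sub_sub_cancel, norm_smul, Real.norm_eq_abs, mul_pow, sq_abs]
    field_simp
  apply le_antisymm
  · refine hl_le u ht x _ fun y => ?_
    rw [← hsdef]
    by_cases hy : ‖x - y‖ ≤ 2 * K * s
    · refine le_csSup hbd ⟨s⁻¹ • (x - y), ?_, ?_⟩
      · rw [mem_closedBall_zero_iff, norm_smul, norm_inv, Real.norm_eq_abs, abs_of_pos hs,
          inv_mul_le_iff₀ hs]
        linarith
      · have e : x - s • s⁻¹ • (x - y) = y := by
          rw [smul_inv_smul₀ hs.ne']; abel
        have := term (s⁻¹ • (x - y))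
        rw [e] at this
        simp only [e]
        exact this.symm
    · have hux : u x ≤ hopfLaxBall (d := d) K u s x := by
        refine le_csSup hbd ⟨0, by simp, by simp⟩
      refine le_trans ?_ hux
      have h1 := hl_lip_le hu x y
      push Not at hy
      have h2 : K * ‖x - y‖ ≤ ‖x - y‖ ^ 2 / (2 * s) := by
        rw [le_div_iff₀ (by positivity)]
        nlinarith [norm_nonneg (x - y)]
      linarith
  · refine csSup_le ((Metric.nonempty_closedBall.2 (by positivity)).image _) ?_
    rintro _ ⟨w, -, rfl⟩
    show u (x - s • w) - s * ‖w‖ ^ 2 / 2 ≤ _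
    rw [← term]
    exact hl_ge hu ht x _

lemma hlb_zero {K : NNReal} {u : 𝔼 → ℝ} {R : ℝ} (hR : ∀ x, R < ‖x‖ → u x = 0)
    {s : ℝ} (h0 : 0 < s) (h1 : s < 1) {x : 𝔼} (hx : R + 2 * K < ‖x‖) :
    hopfLaxBall (d := d) K u s x = 0 := by
  have hz : ∀ w ∈ Metric.closedBall (0 : 𝔼) (2 * (K : ℝ)), u (x - s • w) = 0 := by
    intro w hw
    rw [mem_closedBall_zero_iff] at hw
    apply hR
    have h2 := norm_sub_norm_le x (s • w)
    rw [norm_smul, Real.norm_eq_abs, abs_of_pos h0] at h2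
    nlinarith [norm_nonneg w]
  apply le_antisymm
  · refine csSup_le ((Metric.nonempty_closedBall.2 (by positivity)).image _) ?_
    rintro _ ⟨w, hw, rfl⟩
    simp only [hz w hw]
    have : 0 ≤ s * ‖w‖ ^ 2 / 2 := by positivity
    linarith
  · refine le_csSup ⟨0, ?_⟩ ⟨0, by simp, ?_⟩
    · rintro _ ⟨w, hw, rfl⟩
      simp only [hz w hw]
      have : 0 ≤ s * ‖w‖ ^ 2 / 2 := by positivity
      linarith
    · have := hz 0 (by simp)
      simp only [this]
      simp

lemma hl_gradient_zero {K : NNReal} {u : 𝔼 → ℝ} (hu : LipschitzWith K u) {R : ℝ}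
    (hR : ∀ x, R < ‖x‖ → u x = 0)
    {t : ℝ} (h0 : 0 < t) (h1 : t < 1) {x : 𝔼} (hx : R + 2 * K < ‖x‖) :
    gradient (hopfLax d u t) x = 0 := by
  have : hopfLax d u t =ᶠ[𝓝 x] fun _ => (0 : ℝ) := by
    filter_upwards [(continuous_norm.tendsto x).eventually (lt_mem_nhds hx)] with y hy
    rw [hl_eq_hlb hu h1]
    exact hlb_zero hR (by linarith) (by linarith) hy
  rw [gradient, this.fderiv_eq]
  simp

lemma hl_ae_diff {K : NNReal} {u : 𝔼 → ℝ} (hu : LipschitzWith K u) :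
    ∀ᵐ p ∂((volume : Measure (ℝ × 𝔼)).restrict (Ioo (0 : ℝ) 1 ×ˢ univ)),
      DifferentiableAt ℝ (hopfLax d u p.1) p.2 := by
  have hS : MeasurableSet (Ioo (0 : ℝ) 1 ×ˢ (univ : Set 𝔼)) :=
    measurableSet_Ioo.prod MeasurableSet.univ
  have key : ∀ᵐ p ∂((volume : Measure (ℝ × 𝔼)).restrict (Ioo (0 : ℝ) 1 ×ˢ univ)),
      DifferentiableAt ℝ (hopfLaxBall (d := d) K u (1 - p.1)) p.2 := by
    rw [Measure.volume_eq_prod, ← Measure.prod_restrict, Measure.restrict_univ]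
    rw [Measure.ae_prod_iff_ae_ae]
    · filter_upwards [ae_restrict_mem measurableSet_Ioo] with t ht
      rw [← hl_eq_hlb hu ht.2]
      exact (hl_lipschitz hu ht.2).ae_differentiableAt
    · refine measurableSet_of_differentiableAt_with_param ℝ
        (f := fun (t : ℝ) (x : 𝔼) => hopfLaxBall (d := d) K u (1 - t) x) ?_
      exact (hlb_continuous K hu.continuous).comp
        (((continuous_const (y := (1 : ℝ))).sub continuous_fst).prodMk continuous_snd)
  filter_upwards [key, ae_restrict_mem hS] with p hp hpS
  rwa [hl_eq_hlb hu hpS.1.2]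

lemma hl_meas {K : NNReal} {u : 𝔼 → ℝ} (hu : LipschitzWith K u) :
    AEStronglyMeasurable (fun p : ℝ × 𝔼 => gradient (hopfLax d u p.1) p.2)
      ((volume : Measure (ℝ × 𝔼)).restrict (Ioo (0 : ℝ) 1 ×ˢ univ)) := by
  have hS : MeasurableSet (Ioo (0 : ℝ) 1 ×ˢ (univ : Set 𝔼)) :=
    measurableSet_Ioo.prod MeasurableSet.univ
  have hm : Measurable fun p : ℝ × 𝔼 =>
      fderiv ℝ (hopfLaxBall (d := d) K u (1 - p.1)) p.2 := by
    refine measurable_fderiv_with_param ℝ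
        (f := fun (t : ℝ) (x : 𝔼) => hopfLaxBall (d := d) K u (1 - t) x) ?_
    exact (hlb_continuous K hu.continuous).comp
        (((continuous_const (y := (1 : ℝ))).sub continuous_fst).prodMk continuous_snd)
  have hm2 : Measurable fun p : ℝ × 𝔼 =>
      gradient (hopfLaxBall (d := d) K u (1 - p.1)) p.2 :=
    (InnerProductSpace.toDual ℝ 𝔼).symm.continuous.measurable.comp hm
  refine hm2.aestronglyMeasurable.congr ?_
  filter_upwards [ae_restrict_mem hS] with p hpS
  rw [hl_eq_hlb hu hpS.1.2]

lemma hl_exists_radius {u : 𝔼 → ℝ} (hu : HasCompactSupport u) :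
    ∃ R : ℝ, ∀ x, R < ‖x‖ → u x = 0 := by
  obtain ⟨R, hR⟩ := hu.isCompact.isBounded.exists_norm_le
  refine ⟨R, fun x hx => ?_⟩
  by_contra h
  exact absurd (hR x (subset_tsupport _ h)) (not_le.2 hx)

lemma hl_close {K' : NNReal} {u u' : 𝔼 → ℝ} (hu' : LipschitzWith K' u')
    {M : ℝ} (hM : ∀ y, u y ≤ u' y + M) {t : ℝ} (ht : t < 1) (x : 𝔼) :
    hopfLax d u t x ≤ hopfLax d u' t x + M := by
  refine hl_le u ht x _ fun y => ?_
  linarith [hM y, hl_ge hu' ht x y]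

end Aux

/-- `L²` convergence of the gradients of the perturbed Hopf–Lax
solutions: `∫₀¹∫ |∇φ^τ - ∇φ|² dx dt → 0` as `τ → 0`. -/
theorem hopfLax_gradient_L2_convergence
    (d : ℕ) (C : ℝ) (hC : 0 ≤ C)
    (v h : EuclideanSpace ℝ (Fin d) → ℝ) (L : NNReal)
    (hL : LipschitzWith L v) (hv_supp : HasCompactSupport v)
    (hv_sc : ConvexOn ℝ univ (fun x => v x + (C / 2) * ‖x‖ ^ 2))
    (hh_smooth : ContDiff ℝ 2 h) (hh_supp : HasCompactSupport h)
    (hvh_sc : ∀ τ : ℝ, |τ| ≤ 1 →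
      ConvexOn ℝ univ (fun x => v x + τ * h x + (C / 2) * ‖x‖ ^ 2)) :
    Tendsto
      (fun τ : ℝ =>
        ∫ p in Ioo (0 : ℝ) 1 ×ˢ (univ : Set (EuclideanSpace ℝ (Fin d))),
          ‖gradient (hopfLax d (fun y => v y + τ * h y) p.1) p.2
            - gradient (hopfLax d v p.1) p.2‖ ^ 2)
      (𝓝 0) (𝓝 0) := by
  obtain ⟨Lh, hLh⟩ := hh_smooth.lipschitzWith_of_hasCompactSupport hh_supp (by norm_num)
  obtain ⟨M, hM⟩ := hh_supp.exists_bound_of_continuous hh_smooth.continuous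
  obtain ⟨R₁, hR₁⟩ := hl_exists_radius hv_supp
  obtain ⟨R₂, hR₂⟩ := hl_exists_radius hh_supp
  set K : NNReal := L + Lh with hK
  set R := max R₁ R₂ with hRdef
  have hLip : ∀ τ : ℝ, |τ| ≤ 1 → LipschitzWith K (fun y => v y + τ * h y) := by
    intro τ hτ
    refine hL.add (LipschitzWith.of_le_add_mul Lh fun x y => ?_)
    have h1 := hLh.dist_le_mul x y
    rw [Real.dist_eq] at h1
    have h2 : τ * (h x - h y) ≤ 1 * |h x - h y| := by
      refine (le_abs_self _).trans ?_
      rw [abs_mul]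
      exact mul_le_mul_of_nonneg_right hτ (abs_nonneg _)
    linarith
  have hLv : LipschitzWith K v := by simpa using hLip 0 (by simp)
  have hzero : ∀ τ : ℝ, ∀ x, R < ‖x‖ → v x + τ * h x = 0 := by
    intro τ x hx
    rw [hR₁ x ((le_max_left _ _).trans_lt hx), hR₂ x ((le_max_right _ _).trans_lt hx)]
    simp
  have hzerov : ∀ x, R < ‖x‖ → v x = 0 := fun x hx => hR₁ x ((le_max_left _ _).trans_lt hx)
  have hS : MeasurableSet (Ioo (0 : ℝ) 1 ×ˢ (univ : Set (EuclideanSpace ℝ (Fin d)))) :=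
    measurableSet_Ioo.prod MeasurableSet.univ
  refine tendsto_of_seq_tendsto fun τ hτ => ?_
  have hτ1 : ∀ᶠ n in atTop, |τ n| ≤ 1 := by
    have := (hτ.abs).eventually (gt_mem_nhds (by simp : |(0 : ℝ)| < 1))
    exact this.mono fun n hn => hn.le
  let B : Set (ℝ × EuclideanSpace ℝ (Fin d)) :=
    Icc (0 : ℝ) 1 ×ˢ Metric.closedBall 0 (R + 2 * K)
  have hBc : IsCompact B := isCompact_Icc.prod (isCompact_closedBall _ _)
  have main := tendsto_integral_filter_of_dominated_convergence
    (μ := (volume : Measure (ℝ × EuclideanSpace ℝ (Fin d))).restrict (Ioo (0 : ℝ) 1 ×ˢ univ))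
    (l := atTop)
    (F := fun n p => ‖gradient (hopfLax d (fun y => v y + τ n * h y) p.1) p.2
            - gradient (hopfLax d v p.1) p.2‖ ^ 2) (f := fun _ => (0 : ℝ))
    (B.indicator fun _ => ((K : ℝ) + K) ^ 2) ?_ ?_ ?_ ?_
  · simpa [Function.comp_def] using main
  · filter_upwards [hτ1] with n hn
    exact ((hl_meas (hLip _ hn)).sub (hl_meas hLv)).norm.pow 2
  · filter_upwards [hτ1] with n hn
    filter_upwards [ae_restrict_mem hS] with p hp
    rw [norm_pow, norm_norm]
    by_cases hpB : p ∈ B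
    · rw [indicator_of_mem hpB]
      refine pow_le_pow_left₀ (norm_nonneg _) ((norm_sub_le _ _).trans (add_le_add ?_ ?_)) 2
      · exact hl_gradient_norm_le (hl_lipschitz (hLip _ hn) hp.1.2) _
      · exact hl_gradient_norm_le (hl_lipschitz hLv hp.1.2) _
    · rw [indicator_of_notMem hpB]
      have hx : R + 2 * K < ‖p.2‖ := by
        by_contra hcon
        exact hpB ⟨Ioo_subset_Icc_self hp.1, mem_closedBall_zero_iff.2 (not_lt.1 hcon)⟩
      rw [hl_gradient_zero (hLip _ hn) (hzero _) hp.1.1 hp.1.2 hx,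
        hl_gradient_zero hLv hzerov hp.1.1 hp.1.2 hx]
      simp
  · refine Integrable.restrict ?_
    rw [integrable_indicator_iff hBc.measurableSet]
    exact integrableOn_const hBc.measure_lt_top.ne
  · have hall : ∀ᵐ p ∂((volume : Measure (ℝ × EuclideanSpace ℝ (Fin d))).restrict
        (Ioo (0 : ℝ) 1 ×ˢ univ)), ∀ n, |τ n| ≤ 1 →
        DifferentiableAt ℝ (hopfLax d (fun y => v y + τ n * h y) p.1) p.2 := by
      rw [ae_all_iff]
      intro n
      by_cases hn : |τ n| ≤ 1
      · filter_upwards [hl_ae_diff (hLip _ hn)] with p hp _ using hp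
      · exact Eventually.of_forall fun p hp => absurd hp hn
    filter_upwards [hall, hl_ae_diff hLv, ae_restrict_mem hS] with p hp1 hp2 hpS
    refine hl_gradient_tendsto (k := 2 * (1 - p.1)) ?_ ?_ hp2
    · filter_upwards [hτ1] with n hn z
      exact hl_fderiv_le (fun z θ h0 h1 => hl_semiconvex (hLip _ hn) hpS.1.2 _ z h0 h1)
        (hp1 n hn) z
    · intro y
      have hb : ∀ n z, |τ n * h z| ≤ |τ n| * M := fun n z => by
        rw [abs_mul]
        exact mul_le_mul_of_nonneg_left (hM z) (abs_nonneg _)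
      have hl0 : Tendsto (fun n => |τ n| * M) atTop (𝓝 0) := by
        simpa using hτ.abs.mul_const M
      rw [tendsto_iff_dist_tendsto_zero]
      refine squeeze_zero' (Eventually.of_forall fun _ => dist_nonneg) ?_ hl0
      filter_upwards [hτ1] with n hn
      rw [Real.dist_eq, abs_sub_le_iff]
      constructor
      · have := hl_close (u := fun y => v y + τ n * h y) hLv (M := |τ n| * M)
          (fun z => by linarith [(abs_le.1 (hb n z)).2]) hpS.1.2 y
        linarith
      · have := hl_close (u := v) (hLip _ hn) (M := |τ n| * M)
          (fun z => by linarith [(abs_le.1 (hb n z)).1]) hpS.1.2 y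
        linarith
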